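/- (Strong min-max duality.) For any self-adjoint positive-definite operators K_i on E_i (1≤i≤k), the following identity holds, with both sides valued in [−∞,+∞) and the maximum on the left attained: max over K ∈ Π(K_1,…,K_k) of [ Σ_{j=1}^m d_j log det(B_j Λ_c K Λ_c B_j*) ] + Σ_{j=1}^m d_j dim(E^j) equals the infimum, over all self-adjoint positive-definite V_i on E_i and U_j on E^j satisfying Λ_c B* U_d B Λ_c ≤ V_c, of [ Σ_{i=1}^k c_i ⟨V_i, K_i⟩_HS − Σ_{j=1}^m d_j log det U_j ]. Here log det of a singular positive-semidefinite operator is interpreted as −∞, and ⟨·,·⟩_HS is the Hilbert-Schmidt (trace) inner product. -/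

import Mathlib

open MeasureTheory LinearMap
open scoped RealInnerProductSpace BigOperators NNReal ENNReal

noncomputable section

namespace FRBL

/-- A positive semidefinite (self-adjoint) operator on a real inner product space. -/
def PosSemidef {G : Type*} [NormedAddCommGroup G] [InnerProductSpace ℝ G]
    (A : G →ₗ[ℝ] G) : Prop :=
  A.IsSymmetric ∧ ∀ x : G, 0 ≤ ⟪A x, x⟫

/-- A positive definite (self-adjoint) operator on a real inner product space. -/
def PosDef {G : Type*} [NormedAddCommGroup G] [InnerProductSpace ℝ G]
    (A : G →ₗ[ℝ] G) : Prop :=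
  A.IsSymmetric ∧ ∀ x : G, x ≠ 0 → 0 < ⟪A x, x⟫

variable {k m : ℕ}
  (E : Fin k → Type*) (F : Fin m → Type*)
  [∀ i, NormedAddCommGroup (E i)] [∀ i, InnerProductSpace ℝ (E i)]
  [∀ i, FiniteDimensional ℝ (E i)]
  [∀ i, MeasurableSpace (E i)] [∀ i, BorelSpace (E i)]
  [∀ j, NormedAddCommGroup (F j)] [∀ j, InnerProductSpace ℝ (F j)]
  [∀ j, FiniteDimensional ℝ (F j)]
  [∀ j, MeasurableSpace (F j)] [∀ j, BorelSpace (F j)]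
  (c : Fin k → ℝ) (d : Fin m → ℝ)
  (B : ∀ i j, E i →ₗ[ℝ] F j)

/-- The pointwise domination hypothesis of the forward-reverse Brascamp-Lieb inequality. -/
def Hyp (f : ∀ i, E i → ℝ≥0) (g : ∀ j, F j → ℝ≥0) : Prop :=
  ∀ x : ∀ i, E i,
    (∏ i, f i (x i) ^ c i) ≤ ∏ j, g j (∑ i, c i • B i j (x i)) ^ d j

/-- `D₀` is an admissible constant for the forward-reverse Brascamp-Lieb inequality. -/
def IsBound (D₀ : ℝ) : Prop :=
  ∀ (f : ∀ i, E i → ℝ≥0) (g : ∀ j, F j → ℝ≥0),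
    (∀ i, Measurable (f i)) → (∀ j, Measurable (g j)) →
    Hyp E F c d B f g →
    (∏ i, (∫⁻ x, (f i x : ℝ≥0∞)) ^ c i) ≤
      ENNReal.ofReal (Real.exp D₀) * ∏ j, (∫⁻ y, (g j y : ℝ≥0∞)) ^ d j

/-- The best constant `D(c,d,B)` in the forward-reverse Brascamp-Lieb inequality. -/
def D : EReal :=
  sInf {x : EReal | ∃ D₀ : ℝ, x = (D₀ : EReal) ∧ IsBound E F c d B D₀}

/-- The gaussian constraint `Λ_c B* U_d B Λ_c ≤ V_c`, written via quadratic forms. -/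
def GaussCon (V : ∀ i, E i →ₗ[ℝ] E i) (U : ∀ j, F j →ₗ[ℝ] F j) : Prop :=
  ∀ x : ∀ i, E i,
    (∑ j, d j * ⟪U j (∑ i, c i • B i j (x i)), ∑ i, c i • B i j (x i)⟫) ≤
      ∑ i, c i * ⟪V i (x i), x i⟫

/-- The objective functional in the definition of the gaussian constant. -/
def gaussObj (V : ∀ i, E i →ₗ[ℝ] E i) (U : ∀ j, F j →ₗ[ℝ] F j) : ℝ :=
  (∑ j, d j * Real.log (LinearMap.det (U j)) -
    ∑ i, c i * Real.log (LinearMap.det (V i))) / 2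

/-- The gaussian best constant `D_g(c,d,B)`. -/
def Dg : EReal :=
  sSup {x : EReal | ∃ (V : ∀ i, E i →ₗ[ℝ] E i) (U : ∀ j, F j →ₗ[ℝ] F j),
    (∀ i, PosDef (V i)) ∧ (∀ j, PosDef (U j)) ∧ GaussCon E F c d B V U ∧
    x = (gaussObj E F c d V U : EReal)}

/-- The datum `(c,d,B)` is gaussian-extremizable: the supremum defining `D_g` is
finite and attained. -/
def GaussExt : Prop :=
  ∃ (V : ∀ i, E i →ₗ[ℝ] E i) (U : ∀ j, F j →ₗ[ℝ] F j),
    (∀ i, PosDef (V i)) ∧ (∀ j, PosDef (U j)) ∧ GaussCon E F c d B V U ∧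
    Dg E F c d B = (gaussObj E F c d V U : EReal)

/-- The canonical linear equivalence between `E₀ = ⊕ᵢ Eᵢ` (as `PiLp 2`) and the pi type. -/
def toPi : PiLp 2 E ≃ₗ[ℝ] ∀ i, E i := WithLp.linearEquiv 2 ℝ (∀ i, E i)

/-- Orthogonal projection `π_{E_i} : E₀ → E_i`. -/
def projL (i : Fin k) : PiLp 2 E →ₗ[ℝ] E i := (LinearMap.proj i).comp (toPi E).toLinearMap

/-- The embedding `E_i → E₀`. -/
def singleL (i : Fin k) : E i →ₗ[ℝ] PiLp 2 E :=
  (toPi E).symm.toLinearMap.comp (LinearMap.single ℝ E i)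

/-- The map `B_j : E₀ → E^j`, `x ↦ ∑ᵢ B_{ij} π_{E_i} x`. -/
def Bop (j : Fin m) : PiLp 2 E →ₗ[ℝ] F j := ∑ i, (B i j).comp (projL E i)

/-- `Λ_c = ⊕ᵢ cᵢ id_{E_i}` as an operator on `E₀`. -/
def Lam : PiLp 2 E →ₗ[ℝ] PiLp 2 E := ∑ i, c i • (singleL E i).comp (projL E i)

/-- The set `Π(A_1, …, A_k)` of positive semidefinite "couplings". -/
def Coupling (A : ∀ i, E i →ₗ[ℝ] E i) : Set (PiLp 2 E →ₗ[ℝ] PiLp 2 E) :=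
  {P | PosSemidef P ∧ ∀ (i : Fin k) (v : E i),
    ⟪P (singleL E i v), singleL E i v⟫ = ⟪A i v, v⟫}

/-- The scaling condition `∑ᵢ cᵢ dim Eᵢ = ∑ⱼ dⱼ dim E^j`. -/
def ScalingCond : Prop :=
  ∑ i, c i * (Module.finrank ℝ (E i) : ℝ) = ∑ j, d j * (Module.finrank ℝ (F j) : ℝ)

/-- A subspace `T ⊆ E₀` is of product form, i.e. `T = ⊕ᵢ π_{E_i} T`. -/
def ProductForm (T : Submodule ℝ (PiLp 2 E)) : Prop :=
  ∀ x ∈ T, ∀ i, singleL E i (projL E i x) ∈ T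

/-- The dimension condition over product-form subspaces. -/
def DimCond : Prop :=
  ∀ T : Submodule ℝ (PiLp 2 E), ProductForm E T →
    (∑ i, c i * (Module.finrank ℝ (T.map (projL E i)) : ℝ)) ≤
      ∑ j, d j * (Module.finrank ℝ (T.map (Bop E F B j)) : ℝ)

/-- A critical subspace. -/
def IsCritical (T : Submodule ℝ (PiLp 2 E)) : Prop :=
  T ≠ ⊥ ∧ T ≠ ⊤ ∧ ProductForm E T ∧
    ∑ i, c i * (Module.finrank ℝ (T.map (projL E i)) : ℝ) =
      ∑ j, d j * (Module.finrank ℝ (T.map (Bop E F B j)) : ℝ)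

/-- The datum is simple if it has no critical subspace. -/
def Simple : Prop := ∀ T : Submodule ℝ (PiLp 2 E), ¬ IsCritical E F c d B T

end FRBL

namespace FRBL

/-- `log det` with value `−∞` on operators with non-positive determinant
(in particular on singular positive-semidefinite operators). -/
def elogdet {G : Type*} [AddCommGroup G] [Module ℝ G] (A : G →ₗ[ℝ] G) : EReal :=
  if 0 < LinearMap.det A then ((Real.log (LinearMap.det A) : ℝ) : EReal) else ⊥

variable {k m : ℕ}
  (E : Fin k → Type*) (F : Fin m → Type*)
  [∀ i, NormedAddCommGroup (E i)] [∀ i, InnerProductSpace ℝ (E i)]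
  [∀ i, FiniteDimensional ℝ (E i)]
  [∀ j, NormedAddCommGroup (F j)] [∀ j, InnerProductSpace ℝ (F j)]
  [∀ j, FiniteDimensional ℝ (F j)]
  (c : Fin k → ℝ) (d : Fin m → ℝ)
  (B : ∀ i j, E i →ₗ[ℝ] F j)

/-- The map `Q_j := B_j Λ_c : E₀ → E^j`. -/
def BLam (j : Fin m) : PiLp 2 E →ₗ[ℝ] F j := (Bop E F B j).comp (Lam E c)

/-- The optimality condition of Theorem 2 (structure of gaussian extremizers):
each `B_j Λ_c Π Λ_c B_j*` is invertible and
`∑ⱼ dⱼ Λ_c B_j* (B_j Λ_c Π Λ_c B_j*)⁻¹ B_j Λ_c ≤ V_c` in the quadratic-form sense. -/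
def ExtCond (V : ∀ i, E i →ₗ[ℝ] E i) (P : PiLp 2 E →ₗ[ℝ] PiLp 2 E) : Prop :=
  (∀ j, IsUnit ((BLam E F c B j) ∘ₗ P ∘ₗ LinearMap.adjoint (BLam E F c B j))) ∧
  ∀ x : PiLp 2 E,
    (∑ j, d j * ⟪Ring.inverse ((BLam E F c B j) ∘ₗ P ∘ₗ LinearMap.adjoint (BLam E F c B j))
        (BLam E F c B j x), BLam E F c B j x⟫) ≤
      ∑ i, c i * ⟪V i (projL E i x), projL E i x⟫

/-- A geometric datum. -/
def Geometric : Prop :=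
  ScalingCond E F c d ∧
  ∃ S ∈ Coupling E (fun i => (LinearMap.id : E i →ₗ[ℝ] E i)),
    (∀ j, (BLam E F c B j) ∘ₗ S ∘ₗ LinearMap.adjoint (BLam E F c B j) = LinearMap.id) ∧
    ∀ x : PiLp 2 E, (∑ j, d j * ⟪BLam E F c B j x, BLam E F c B j x⟫) ≤ ⟪Lam E c x, x⟫

/-- Equivalence of data: `B'_j = C_j⁻¹ B_j C⁻¹` for invertible `C, C_j`. -/
def EquivData (B' : ∀ i j, E i →ₗ[ℝ] F j) : Prop :=
  ∃ (C : PiLp 2 E ≃ₗ[ℝ] PiLp 2 E) (Cj : ∀ j, F j ≃ₗ[ℝ] F j),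
    ∀ j, Bop E F B' j =
      ((Cj j).symm.toLinearMap ∘ₗ Bop E F B j) ∘ₗ C.symm.toLinearMap

/-- `V_c = ⊕ᵢ cᵢ Vᵢ` as an operator on `E₀`. -/
def blockDiag (V : ∀ i, E i →ₗ[ℝ] E i) : PiLp 2 E →ₗ[ℝ] PiLp 2 E :=
  ∑ i, c i • ((singleL E i) ∘ₗ (V i)) ∘ₗ (projL E i)

/-- `Θ = V_c − ∑ⱼ dⱼ Λ_c B_j* U_j B_j Λ_c`. -/
def Theta (V : ∀ i, E i →ₗ[ℝ] E i) (U : ∀ j, F j →ₗ[ℝ] F j) :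
    PiLp 2 E →ₗ[ℝ] PiLp 2 E :=
  blockDiag E c V -
    ∑ j, d j • (LinearMap.adjoint (BLam E F c B j) ∘ₗ (U j)) ∘ₗ (BLam E F c B j)

end FRBL

namespace FRBL

/-- Borel structure on submodules (inherited from the ambient space). -/
instance subBorel {G : Type*} [AddCommGroup G] [Module ℝ G] [TopologicalSpace G]
    [MeasurableSpace G] [BorelSpace G] (T : Submodule ℝ G) : BorelSpace ↥T :=
  Subtype.borelSpace (T : Set G)

/-- The maximal dimension of a subspace on which the self-adjoint operator `Q` is positive
definite; by Sylvester's law of inertia this is the number of positive eigenvalues of `Q`,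
counted with multiplicity. -/
def posIndex {H : Type*} [NormedAddCommGroup H] [InnerProductSpace ℝ H]
    (Q : H →ₗ[ℝ] H) : ℕ :=
  sSup {r : ℕ | ∃ W : Submodule ℝ H,
    (∀ x ∈ W, x ≠ 0 → 0 < ⟪Q x, x⟫) ∧ Module.finrank ℝ W = r}

/-- The standard gaussian probability measure on a Euclidean space. -/
def stdGaussian (G : Type*) [NormedAddCommGroup G] [InnerProductSpace ℝ G]
    [FiniteDimensional ℝ G] [MeasurableSpace G] [BorelSpace G] :
    Measure G :=
  volume.withDensity fun x =>
    ENNReal.ofReal ((2 * Real.pi) ^ (-(Module.finrank ℝ G : ℝ) / 2) *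
      Real.exp (-‖x‖ ^ 2 / 2))

/-- `K_s = (|s|^{1/s} |s'|^{1/s'})^{1/2}`. -/
def Kconst (s s' : ℝ) : ℝ := Real.sqrt (|s| ^ (1 / s) * |s'| ^ (1 / s'))

variable {k m : ℕ}
  (E : Fin k → Type*) (F : Fin m → Type*)
  [∀ i, NormedAddCommGroup (E i)] [∀ i, InnerProductSpace ℝ (E i)]
  [∀ i, FiniteDimensional ℝ (E i)]
  [∀ j, NormedAddCommGroup (F j)] [∀ j, InnerProductSpace ℝ (F j)]
  [∀ j, FiniteDimensional ℝ (F j)]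
  (c : Fin k → ℝ) (d : Fin m → ℝ)
  (B : ∀ i j, E i →ₗ[ℝ] F j)

/-- The objective functional `∑ⱼ dⱼ log det Uⱼ − ∑ᵢ cᵢ log det Vᵢ`. -/
def objective (V : ∀ i, E i →ₗ[ℝ] E i) (U : ∀ j, F j →ₗ[ℝ] F j) : ℝ :=
  ∑ j, d j * Real.log (LinearMap.det (U j)) - ∑ i, c i * Real.log (LinearMap.det (V i))

/-- Feasibility for the optimization problem defining `D_g`: positive definiteness
together with the constraint `Θ ≥ 0`. -/
def Admissible (V : ∀ i, E i →ₗ[ℝ] E i) (U : ∀ j, F j →ₗ[ℝ] F j) : Prop :=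
  (∀ i, PosDef (V i)) ∧ (∀ j, PosDef (U j)) ∧ PosSemidef (Theta E F c d B V U)

/-- Global maximality in the optimization problem defining `D_g`. -/
def IsGlobalMax (V : ∀ i, E i →ₗ[ℝ] E i) (U : ∀ j, F j →ₗ[ℝ] F j) : Prop :=
  Admissible E F c d B V U ∧
    ∀ V' U', Admissible E F c d B V' U' →
      objective E F c d V' U' ≤ objective E F c d V U

/-- Local maximality in the optimization problem defining `D_g`. -/
def IsLocalMax (V : ∀ i, E i →ₗ[ℝ] E i) (U : ∀ j, F j →ₗ[ℝ] F j) : Prop :=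
  Admissible E F c d B V U ∧
    ∃ ε : ℝ, 0 < ε ∧
      ∀ V' U', Admissible E F c d B V' U' →
        (∀ i, ‖LinearMap.toContinuousLinearMap (V' i - V i)‖ < ε) →
        (∀ j, ‖LinearMap.toContinuousLinearMap (U' j - U j)‖ < ε) →
        objective E F c d V' U' ≤ objective E F c d V U

end FRBL

namespace FRBL

lemma PosDef.posSemidef {G : Type*} [NormedAddCommGroup G] [InnerProductSpace ℝ G]
    {A : G →ₗ[ℝ] G} (hA : PosDef A) : PosSemidef A := by
  refine ⟨hA.1, fun x => ?_⟩
  by_cases hx : x = 0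
  · simp [hx]
  · exact (hA.2 x hx).le

section Operators

variable {G : Type*} [NormedAddCommGroup G] [InnerProductSpace ℝ G] [FiniteDimensional ℝ G]

/-- Every positive semidefinite operator has a symmetric square root. -/
lemma PosSemidef.exists_sq {A : G →ₗ[ℝ] G} (hA : PosSemidef A) :
    ∃ S : G →ₗ[ℝ] G, S.IsSymmetric ∧ S ∘ₗ S = A := by
  classical
  set b := hA.1.eigenvectorBasis rfl with hb
  set l := hA.1.eigenvalues rfl with hl
  have hAb : ∀ a, A (b a) = l a • b a := fun a => hA.1.apply_eigenvectorBasis rfl a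
  have hl0 : ∀ a, 0 ≤ l a := fun a => by
    have := hA.2 (b a)
    rw [hAb, inner_smul_left, real_inner_self_eq_norm_sq, b.norm_eq_one] at this
    simpa using this
  refine ⟨∑ a, √(l a) • (InnerProductSpace.rankOne ℝ (b a) (b a)).toLinearMap, ?_, ?_⟩
  · intro x y
    simp [sum_inner, inner_sum, inner_smul_left, inner_smul_right, mul_comm, real_inner_comm]
  · refine b.toBasis.ext fun a => ?_
    have h : ∀ a, (∑ a, √(l a) • (InnerProductSpace.rankOne ℝ (b a) (b a)).toLinearMap) (b a) =
        √(l a) • b a := fun a => by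
      simp [b.inner_eq_ite]
    rw [b.coe_toBasis, LinearMap.comp_apply, h, map_smul, h, hAb, smul_smul,
      Real.mul_self_sqrt (hl0 a)]

/-- The trace of a product of two positive semidefinite operators is nonnegative. -/
lemma PosSemidef.trace_comp_nonneg {A P : G →ₗ[ℝ] G} (hA : PosSemidef A) (hP : PosSemidef P) :
    0 ≤ LinearMap.trace ℝ G (A ∘ₗ P) := by
  obtain ⟨S, hS, rfl⟩ := hP.exists_sq
  rw [← LinearMap.comp_assoc, LinearMap.trace_comp_comm',
    LinearMap.trace_eq_sum_inner _ (stdOrthonormalBasis ℝ G)]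
  refine Finset.sum_nonneg fun a _ => ?_
  rw [LinearMap.comp_apply, LinearMap.comp_apply, ← hS, real_inner_comm]
  exact hA.2 _

lemma PosSemidef.inner_le_trace {P : G →ₗ[ℝ] G} (hP : PosSemidef P) (x : G) :
    ⟪P x, x⟫ ≤ LinearMap.trace ℝ G P * ‖x‖ ^ 2 := by
  have hA : PosSemidef ((‖x‖ ^ 2) • LinearMap.id -
      (InnerProductSpace.rankOne ℝ x x).toLinearMap : G →ₗ[ℝ] G) := by
    refine ⟨fun y z => ?_, fun y => ?_⟩
    · simp [inner_sub_left, inner_sub_right, inner_smul_left, inner_smul_right, mul_comm,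
        real_inner_comm]
    · have := real_inner_mul_inner_self_le x y
      simp only [LinearMap.sub_apply, LinearMap.smul_apply, LinearMap.id_apply,
        ContinuousLinearMap.coe_coe, InnerProductSpace.rankOne_apply, inner_sub_left,
        inner_smul_left, conj_trivial, ← real_inner_self_eq_norm_sq]
      linarith
  have := hA.trace_comp_nonneg hP
  rw [LinearMap.trace_comp_comm', LinearMap.comp_sub, map_sub, LinearMap.comp_smul,
    LinearMap.comp_id, map_smul] at this
  have h2 : P ∘ₗ (InnerProductSpace.rankOne ℝ x x).toLinearMap =
      (InnerProductSpace.rankOne ℝ (P x) x).toLinearMap := by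
    ext y; simp
  rw [h2, InnerProductSpace.trace_rankOne, real_inner_comm] at this
  simp at this
  linarith

lemma PosSemidef.norm_apply_le {P : G →ₗ[ℝ] G} (hP : PosSemidef P) (x : G) :
    ‖P x‖ ≤ LinearMap.trace ℝ G P * ‖x‖ := by
  obtain ⟨S, hS, hSP⟩ := hP.exists_sq
  have ht : 0 ≤ LinearMap.trace ℝ G P := by
    have := PosSemidef.trace_comp_nonneg (A := LinearMap.id) (P := P)
      ⟨fun _ _ => rfl, fun x => real_inner_self_nonneg⟩ hP
    simpa using this
  have hn : ∀ y, ‖S y‖ ≤ √(LinearMap.trace ℝ G P) * ‖y‖ := fun y => by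
    refine le_of_sq_le_sq ?_ (by positivity)
    rw [mul_pow, Real.sq_sqrt ht, ← real_inner_self_eq_norm_sq, ← hS, ← LinearMap.comp_apply, hSP]
    exact hP.inner_le_trace y
  calc ‖P x‖ = ‖S (S x)‖ := by rw [← hSP]; rfl
    _ ≤ √(LinearMap.trace ℝ G P) * (√(LinearMap.trace ℝ G P) * ‖x‖) :=
      (hn _).trans (by gcongr; exact hn x)
    _ = _ := by rw [← mul_assoc, Real.mul_self_sqrt ht]

lemma PosSemidef.det_nonneg {A : G →ₗ[ℝ] G} (hA : PosSemidef A) : 0 ≤ LinearMap.det A := by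
  obtain ⟨S, -, rfl⟩ := hA.exists_sq
  rw [LinearMap.det_comp]
  exact mul_self_nonneg _

lemma PosSemidef.log_det_le {A : G →ₗ[ℝ] G} (hA : PosSemidef A) (h : 0 < LinearMap.det A) :
    Real.log (LinearMap.det A) ≤ LinearMap.trace ℝ G A - Module.finrank ℝ G := by
  have hs : A.IsSymmetric := hA.1
  have hd := hs.det_eq_prod_eigenvalues rfl
  have ht := hs.trace_eq_sum_eigenvalues rfl
  simp only [RCLike.ofReal_real_eq_id, _root_.id] at hd ht
  have hne : ∀ i, hs.eigenvalues rfl i ≠ 0 := by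
    have := hd ▸ h.ne'
    simpa [Finset.prod_eq_zero_iff] using this
  have hpos : ∀ i, 0 < hs.eigenvalues rfl i := fun i => by
    refine lt_of_le_of_ne ?_ (hne i).symm
    have := hA.2 (hs.eigenvectorBasis rfl i)
    rw [hs.apply_eigenvectorBasis, inner_smul_left, real_inner_self_eq_norm_sq,
      OrthonormalBasis.norm_eq_one] at this
    simpa using this
  rw [hd, ht, Real.log_prod fun i _ => hne i]
  calc _ ≤ ∑ i, (hs.eigenvalues rfl i - 1) :=
        Finset.sum_le_sum fun i _ => Real.log_le_sub_one_of_pos (hpos i)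
    _ = _ := by simp

lemma PosDef.det_pos {A : G →ₗ[ℝ] G} (hA : PosDef A) : 0 < LinearMap.det A := by
  refine lt_of_le_of_ne hA.posSemidef.det_nonneg fun h => ?_
  obtain ⟨x, hx, hx0⟩ := (Submodule.ne_bot_iff _).1 (LinearMap.bot_lt_ker_of_det_eq_zero h.symm).ne'
  have := hA.2 x hx0
  simp [LinearMap.mem_ker.1 hx] at this

lemma PosSemidef.posDef_of_det_pos {A : G →ₗ[ℝ] G} (hA : PosSemidef A)
    (h : 0 < LinearMap.det A) : PosDef A := by
  refine ⟨hA.1, fun x hx => lt_of_le_of_ne (hA.2 x) fun h0 => hx ?_⟩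
  obtain ⟨S, hS, rfl⟩ := hA.exists_sq
  rw [LinearMap.comp_apply, hS, eq_comm, inner_self_eq_zero] at h0
  refine (LinearMap.equivOfDetNeZero _ h.ne').injective ?_
  simp [LinearMap.equivOfDetNeZero, h0]

/-- The inequality `log det M + log det U ≤ tr (U M) - dim` behind weak duality. -/
lemma log_det_add_log_det_le {U M : G →ₗ[ℝ] G} (hU : PosDef U) (hM : PosSemidef M)
    (h : 0 < LinearMap.det M) :
    Real.log (LinearMap.det M) + Real.log (LinearMap.det U) ≤
      LinearMap.trace ℝ G (U ∘ₗ M) - Module.finrank ℝ G := by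
  have hUd := hU.det_pos
  obtain ⟨S, hS, rfl⟩ := hU.posSemidef.exists_sq
  have hps : PosSemidef (S ∘ₗ M ∘ₗ S) :=
    ⟨fun x y => by simp [hS _ _, hM.1 _ _], fun x => by simpa [hS _ _] using hM.2 (S x)⟩
  have hdet : LinearMap.det (S ∘ₗ M ∘ₗ S) = LinearMap.det M * LinearMap.det (S ∘ₗ S) := by
    simp only [LinearMap.det_comp]; ring
  have := hps.log_det_le (hdet ▸ mul_pos h hUd)
  rw [hdet, Real.log_mul h.ne' hUd.ne'] at this
  rwa [LinearMap.comp_assoc, LinearMap.trace_comp_comm', LinearMap.comp_assoc]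

/-- First-order expansion of the determinant at the identity. -/
lemma hasDerivAt_det_one_add (X : G →ₗ[ℝ] G) :
    HasDerivAt (fun t : ℝ => LinearMap.det (LinearMap.id + t • X)) (LinearMap.trace ℝ G X) 0 := by
  let b := Module.finBasis ℝ G
  obtain ⟨q, hq⟩ : ∃ q : Polynomial ℝ, ∀ t : ℝ, LinearMap.det (LinearMap.id + t • X) =
      1 + LinearMap.trace ℝ G X * t + q.eval t * t ^ 2 := by
    refine ⟨(Matrix.det (1 + (Polynomial.X : Polynomial ℝ) •
      (LinearMap.toMatrix b b X).map Polynomial.C)).divX.divX, fun t => ?_⟩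
    rw [← LinearMap.det_toMatrix b, map_add, map_smul, LinearMap.toMatrix_id,
      Matrix.det_one_add_smul, ← LinearMap.trace_eq_matrix_trace]
  simp only [hq]
  have h1 := ((hasDerivAt_const (0 : ℝ) (1 : ℝ)).add
    ((hasDerivAt_id (0 : ℝ)).const_mul (LinearMap.trace ℝ G X))).add
    ((q.hasDerivAt 0).mul ((hasDerivAt_id (0 : ℝ)).pow 2))
  convert! h1 using 1
  simp

lemma hasDerivAt_log_det_one_add (X : G →ₗ[ℝ] G) :
    HasDerivAt (fun t : ℝ => Real.log (LinearMap.det (LinearMap.id + t • X)))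
      (LinearMap.trace ℝ G X) 0 := by
  simpa using (hasDerivAt_det_one_add X).log (by simp)

/-- Linear functionals on operators are represented, on symmetric operators, by the trace pairing
with a symmetric operator. -/
lemma exists_symmetric_trace_repr (f : (G →ₗ[ℝ] G) →ₗ[ℝ] ℝ) :
    ∃ V : G →ₗ[ℝ] G, V.IsSymmetric ∧ ∀ D : G →ₗ[ℝ] G, D.IsSymmetric →
      f D = LinearMap.trace ℝ G (V ∘ₗ D) := by
  let b := stdOrthonormalBasis ℝ G
  let r : G → G → (G →ₗ[ℝ] G) := fun x y => (InnerProductSpace.rankOne ℝ x y).toLinearMap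
  let Y : G →ₗ[ℝ] G := ∑ a, ∑ a', f (r (b a) (b a')) • r (b a) (b a')
  have hY : ∀ D : G →ₗ[ℝ] G, f D = LinearMap.trace ℝ G (LinearMap.adjoint Y ∘ₗ D) := by
    intro D
    have hD : D = ∑ a, ∑ a', ⟪b a, D (b a')⟫ • r (b a) (b a') := by
      refine b.toBasis.ext fun c => ?_
      simp [r, b.inner_eq_ite, LinearMap.sum_apply, b.sum_repr']
    have hYb : ∀ c, Y (b c) = ∑ a, f (r (b a) (b c)) • b a := by
      intro c
      simp [Y, r, b.inner_eq_ite, LinearMap.sum_apply]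
    conv_lhs => rw [hD]
    rw [LinearMap.trace_eq_sum_inner _ b, Finset.sum_comm, map_sum]
    refine Finset.sum_congr rfl fun c _ => ?_
    rw [LinearMap.comp_apply, LinearMap.adjoint_inner_right, hYb]
    simp [sum_inner, inner_smul_left, mul_comm]
  refine ⟨(1 / 2 : ℝ) • (Y + LinearMap.adjoint Y), fun x y => ?_, fun D hD => ?_⟩
  · simp [inner_smul_left, inner_smul_right, inner_add_left, inner_add_right,
      LinearMap.adjoint_inner_left, LinearMap.adjoint_inner_right, add_comm]
  · have h : LinearMap.trace ℝ G (LinearMap.adjoint Y ∘ₗ D) = LinearMap.trace ℝ G (Y ∘ₗ D) := by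
      rw [LinearMap.trace_eq_sum_inner _ b, LinearMap.trace_comp_comm',
        LinearMap.trace_eq_sum_inner _ b]
      refine Finset.sum_congr rfl fun c _ => ?_
      rw [LinearMap.comp_apply, LinearMap.comp_apply, LinearMap.adjoint_inner_right,
        real_inner_comm, hD]
    rw [hY, LinearMap.smul_comp, LinearMap.add_comp, map_smul, map_add, h, smul_eq_mul]
    ring

end Operators

lemma isCompact_of_isClosed_of_norm_le {X : Type*} [NormedAddCommGroup X] [NormedSpace ℝ X]
    [FiniteDimensional ℝ X] {s : Set X} (hs : IsClosed s) (R : ℝ) (hR : ∀ x ∈ s, ‖x‖ ≤ R) :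
    IsCompact s :=
  have : ProperSpace X := FiniteDimensional.proper_real X
  (isCompact_closedBall (0 : X) R).of_isClosed_subset hs fun x hx =>
    mem_closedBall_zero_iff.2 (hR x hx)

/-- Conic duality for a closed convex cone on which `‖P‖` is controlled by a linear functional of
the constraint value `Φ P`. -/
lemma exists_dual_of_cone {X Y : Type*} [NormedAddCommGroup X] [NormedSpace ℝ X]
    [FiniteDimensional ℝ X] [NormedAddCommGroup Y] [NormedSpace ℝ Y] [FiniteDimensional ℝ Y]
    (Φ : X →ₗ[ℝ] Y) (τ : X →ₗ[ℝ] ℝ) (θ : Y →ₗ[ℝ] ℝ) (C : Set X) (hC : IsClosed C)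
    (hadd : ∀ x ∈ C, ∀ y ∈ C, x + y ∈ C) (hsmul : ∀ r : ℝ, 0 ≤ r → ∀ x ∈ C, r • x ∈ C)
    (hθ : ∀ x ∈ C, ‖x‖ ≤ θ (Φ x)) (y₀ : Y) (hne : ∃ x ∈ C, Φ x = y₀) (α : ℝ)
    (hα : ∀ x ∈ C, Φ x = y₀ → τ x ≤ α) {ε : ℝ} (hε : 0 < ε) :
    ∃ f : Y →ₗ[ℝ] ℝ, (∀ x ∈ C, τ x ≤ f (Φ x)) ∧ f y₀ < α + ε := by
  have : ProperSpace X := FiniteDimensional.proper_real X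
  have hΦc : Continuous Φ := Φ.continuous_of_finiteDimensional
  have hτc : Continuous τ := τ.continuous_of_finiteDimensional
  have hθc : Continuous θ := θ.continuous_of_finiteDimensional
  let S : Set (Y × ℝ) := {z | ∃ x ∈ C, Φ x = z.1 ∧ z.2 ≤ τ x}
  have hScl : IsClosed S := by
    refine IsSeqClosed.isClosed fun z w hz hzw => ?_
    choose x hxC hxΦ hxτ using hz
    have h1 := (continuous_fst.tendsto w).comp hzw
    have h2 := (continuous_snd.tendsto w).comp hzw
    obtain ⟨R, hR⟩ := ((hθc.tendsto _).comp h1).bddAbove_range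
    have hxR : ∀ n, x n ∈ Metric.closedBall (0 : X) R := fun n => by
      rw [mem_closedBall_zero_iff]
      refine (hθ _ (hxC n)).trans ?_
      rw [hxΦ]
      exact hR ⟨n, rfl⟩
    obtain ⟨a, -, φ, hφ, ha⟩ := (isCompact_closedBall (0 : X) R).tendsto_subseq hxR
    refine ⟨a, hC.mem_of_tendsto ha (Filter.Eventually.of_forall fun n => hxC _), ?_, ?_⟩
    · refine tendsto_nhds_unique ((hΦc.tendsto a).comp ha) ?_
      refine (h1.comp hφ.tendsto_atTop).congr fun n => ?_
      exact (hxΦ _).symm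
    · exact le_of_tendsto_of_tendsto' (h2.comp hφ.tendsto_atTop) ((hτc.tendsto a).comp ha)
        fun n => hxτ _
  have hSadd : ∀ z ∈ S, ∀ w ∈ S, z + w ∈ S := by
    rintro z ⟨x, hx, hx1, hx2⟩ w ⟨y, hy, hy1, hy2⟩
    exact ⟨x + y, hadd x hx y hy, by simp [hx1, hy1], by simpa using add_le_add hx2 hy2⟩
  have hSsmul : ∀ r : ℝ, 0 ≤ r → ∀ z ∈ S, r • z ∈ S := by
    rintro r hr z ⟨x, hx, hx1, hx2⟩
    exact ⟨r • x, hsmul r hr x hx, by simp [hx1],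
      by simpa using mul_le_mul_of_nonneg_left hx2 hr⟩
  have hSconv : Convex ℝ S := fun z hz w hw a b ha hb _ =>
    hSadd _ (hSsmul a ha z hz) _ (hSsmul b hb w hw)
  have hnot : (y₀, α + ε) ∉ S := by
    rintro ⟨x, hx, hx1, hx2⟩
    have := hα x hx hx1
    simp only at hx2
    linarith
  obtain ⟨g, u, hgS, hgu⟩ := geometric_hahn_banach_closed_point hSconv hScl hnot
  have hg0 : ∀ z ∈ S, g z ≤ 0 := by
    intro z hz
    by_contra! h
    obtain ⟨n, hn⟩ := exists_nat_gt (u / g z)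
    have h1 := hgS _ (hSsmul n n.cast_nonneg z hz)
    rw [map_smul, smul_eq_mul] at h1
    rw [div_lt_iff₀ h] at hn
    linarith
  obtain ⟨x₀, hx₀, hx₀y⟩ := hne
  have hu : 0 < u := by
    have := hgS _ (hSsmul 0 le_rfl (y₀, τ x₀) ⟨x₀, hx₀, hx₀y, le_rfl⟩)
    simpa using this
  have hsplit : ∀ y t, g (y, t) = g (y, 0) + t * g (0, 1) := fun y t => by
    have : (y, t) = (y, (0 : ℝ)) + t • ((0 : Y), (1 : ℝ)) := by simp
    rw [this, map_add, map_smul, smul_eq_mul]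
  have hy0 : 0 < g (0, 1) := by
    have h1 := hg0 (y₀, τ x₀) ⟨x₀, hx₀, hx₀y, le_rfl⟩
    have h2 := hα x₀ hx₀ hx₀y
    rw [hsplit] at h1 hgu
    by_contra! h
    nlinarith
  refine ⟨-((g (0, 1))⁻¹ • (g.toLinearMap ∘ₗ LinearMap.inl ℝ Y ℝ)), fun x hx => ?_, ?_⟩
  · have h1 := hg0 (Φ x, τ x) ⟨x, hx, rfl, le_rfl⟩
    rw [hsplit] at h1
    simp only [LinearMap.neg_apply, LinearMap.smul_apply, LinearMap.comp_apply,
      LinearMap.inl_apply, ContinuousLinearMap.coe_coe, smul_eq_mul]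
    rw [← mul_neg, inv_mul_eq_div, le_div_iff₀ hy0]
    linarith
  · rw [hsplit] at hgu
    simp only [LinearMap.neg_apply, LinearMap.smul_apply, LinearMap.comp_apply,
      LinearMap.inl_apply, ContinuousLinearMap.coe_coe, smul_eq_mul]
    rw [← mul_neg, inv_mul_eq_div, div_lt_iff₀ hy0]
    linarith

section Blocks

variable {k : ℕ} (E : Fin k → Type*)
  [∀ i, NormedAddCommGroup (E i)] [∀ i, InnerProductSpace ℝ (E i)]

/-- The `i`-th diagonal block of an operator on `E₀`. -/
def block (i : Fin k) : (PiLp 2 E →ₗ[ℝ] PiLp 2 E) →ₗ[ℝ] (E i →ₗ[ℝ] E i) where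
  toFun P := projL E i ∘ₗ P ∘ₗ singleL E i
  map_add' _ _ := by ext; simp
  map_smul' _ _ := by ext; simp

/-- The block-diagonal operator `⊕ᵢ Vᵢ` on `E₀`. -/
def blockSum (V : ∀ i, E i →ₗ[ℝ] E i) : PiLp 2 E →ₗ[ℝ] PiLp 2 E :=
  ∑ i, singleL E i ∘ₗ V i ∘ₗ projL E i

lemma projL_apply (i : Fin k) (x : PiLp 2 E) : projL E i x = x i := rfl

lemma singleL_apply (i i' : Fin k) (v : E i) : singleL E i v i' = (Pi.single i v : ∀ i, E i) i' :=
  rfl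

lemma inner_singleL (i : Fin k) (x : PiLp 2 E) (v : E i) :
    ⟪x, singleL E i v⟫ = ⟪projL E i x, v⟫ := by
  classical
  rw [PiLp.inner_apply, Finset.sum_eq_single i]
  · simp [projL_apply, singleL_apply]
  · intro b _ hb
    simp [singleL_apply, Pi.single_eq_of_ne hb]
  · simp

lemma projL_blockSum (V : ∀ i, E i →ₗ[ℝ] E i) (i : Fin k) (x : PiLp 2 E) :
    projL E i (blockSum E V x) = V i (projL E i x) := by
  classical
  rw [blockSum, LinearMap.sum_apply, map_sum, Finset.sum_eq_single i]
  · simp [projL_apply, singleL_apply]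
  · intro b _ hb
    simp [projL_apply, singleL_apply, Pi.single_eq_of_ne hb.symm]
  · simp

lemma inner_blockSum (V : ∀ i, E i →ₗ[ℝ] E i) (x y : PiLp 2 E) :
    ⟪blockSum E V x, y⟫ = ∑ i, ⟪V i (projL E i x), projL E i y⟫ := by
  rw [PiLp.inner_apply]
  exact Finset.sum_congr rfl fun i _ => by rw [← projL_apply, projL_blockSum]; rfl

lemma blockSum_id : blockSum E (fun _ => LinearMap.id) = LinearMap.id := by
  refine LinearMap.ext fun x => ext_inner_right ℝ fun y => ?_
  rw [inner_blockSum, PiLp.inner_apply]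
  rfl

lemma block_isSymmetric {P : PiLp 2 E →ₗ[ℝ] PiLp 2 E} (hP : P.IsSymmetric) (i : Fin k) :
    (block E i P).IsSymmetric := fun v w => by
  change ⟪projL E i (P (singleL E i v)), w⟫ = ⟪v, projL E i (P (singleL E i w))⟫
  rw [← inner_singleL, hP, real_inner_comm, inner_singleL, real_inner_comm]

lemma block_blockSum (V : ∀ i, E i →ₗ[ℝ] E i) (i : Fin k) : block E i (blockSum E V) = V i := by
  ext v
  change projL E i (blockSum E V (singleL E i v)) = V i v
  rw [projL_blockSum]
  simp [projL_apply, singleL_apply]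

lemma mem_coupling_iff {K : ∀ i, E i →ₗ[ℝ] E i} (hK : ∀ i, (K i).IsSymmetric)
    {P : PiLp 2 E →ₗ[ℝ] PiLp 2 E} :
    P ∈ Coupling E K ↔ PosSemidef P ∧ ∀ i, block E i P = K i := by
  refine and_congr_right fun hP => forall_congr' fun i => ⟨fun h => ?_, fun h v => ?_⟩
  · rw [← sub_eq_zero, ← ((block_isSymmetric E hP.1 i).sub (hK i)).inner_map_self_eq_zero]
    intro v
    rw [LinearMap.sub_apply, inner_sub_left, ← h v, inner_singleL, sub_eq_zero]
    rfl
  · rw [inner_singleL, ← h]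
    rfl

lemma blockSum_mem_coupling {K : ∀ i, E i →ₗ[ℝ] E i} (hK : ∀ i, PosDef (K i)) :
    blockSum E K ∈ Coupling E K := by
  rw [mem_coupling_iff E fun i => (hK i).1]
  refine ⟨⟨fun x y => ?_, fun x => ?_⟩, block_blockSum E K⟩
  · rw [inner_blockSum, real_inner_comm, inner_blockSum]
    exact Finset.sum_congr rfl fun i _ => by rw [(hK i).1, real_inner_comm]
  · rw [inner_blockSum]
    exact Finset.sum_nonneg fun i _ => (hK i).posSemidef.2 _

lemma PosSemidef.add {G : Type*} [NormedAddCommGroup G] [InnerProductSpace ℝ G]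
    {A A' : G →ₗ[ℝ] G} (hA : PosSemidef A) (hA' : PosSemidef A') : PosSemidef (A + A') :=
  ⟨hA.1.add hA'.1, fun x => by
    rw [LinearMap.add_apply, inner_add_left]; exact add_nonneg (hA.2 x) (hA'.2 x)⟩

lemma PosSemidef.smul {G : Type*} [NormedAddCommGroup G] [InnerProductSpace ℝ G]
    {A : G →ₗ[ℝ] G} (hA : PosSemidef A) {r : ℝ} (hr : 0 ≤ r) : PosSemidef (r • A) :=
  ⟨fun x y => by simp [inner_smul_left, inner_smul_right, hA.1 x y], fun x => by
    rw [LinearMap.smul_apply, inner_smul_left]; exact mul_nonneg (by simpa using hr) (hA.2 x)⟩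

lemma isClosed_posSemidef {G : Type*} [NormedAddCommGroup G] [InnerProductSpace ℝ G] :
    IsClosed {P : G →L[ℝ] G | PosSemidef P.toLinearMap} := by
  have : {P : G →L[ℝ] G | PosSemidef P.toLinearMap} =
      (⋂ x, ⋂ y, {P : G →L[ℝ] G | ⟪P x, y⟫ = ⟪x, P y⟫}) ∩ ⋂ x, {P : G →L[ℝ] G | 0 ≤ ⟪P x, x⟫} := by
    ext P
    simp [PosSemidef, LinearMap.IsSymmetric]
  rw [this]
  refine (isClosed_iInter fun x => isClosed_iInter fun y => isClosed_eq ?_ ?_).inter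
    (isClosed_iInter fun x => isClosed_le ?_ ?_) <;> fun_prop

lemma PosSemidef.opNorm_le {G : Type*} [NormedAddCommGroup G] [InnerProductSpace ℝ G]
    [FiniteDimensional ℝ G] {P : G →L[ℝ] G} (hP : PosSemidef P.toLinearMap) :
    ‖P‖ ≤ LinearMap.trace ℝ G P.toLinearMap := by
  refine P.opNorm_le_bound ?_ hP.norm_apply_le
  simpa using PosSemidef.trace_comp_nonneg (A := LinearMap.id)
    ⟨fun _ _ => rfl, fun x => real_inner_self_nonneg⟩ hP

variable [∀ i, FiniteDimensional ℝ (E i)]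

lemma trace_blockSum_comp (V : ∀ i, E i →ₗ[ℝ] E i) (P : PiLp 2 E →ₗ[ℝ] PiLp 2 E) :
    LinearMap.trace ℝ _ (blockSum E V ∘ₗ P) =
      ∑ i, LinearMap.trace ℝ (E i) (V i ∘ₗ block E i P) := by
  rw [blockSum, ← Module.End.mul_eq_comp, Finset.sum_mul, map_sum]
  refine Finset.sum_congr rfl fun i _ => ?_
  rw [Module.End.mul_eq_comp, LinearMap.comp_assoc, LinearMap.trace_comp_comm']
  rfl

lemma trace_eq_sum_trace_block (P : PiLp 2 E →ₗ[ℝ] PiLp 2 E) :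
    LinearMap.trace ℝ _ P = ∑ i, LinearMap.trace ℝ (E i) (block E i P) := by
  simpa [blockSum_id] using trace_blockSum_comp E (fun _ => LinearMap.id) P

lemma isCompact_coupling {K : ∀ i, E i →ₗ[ℝ] E i} (hK : ∀ i, (K i).IsSymmetric) :
    IsCompact {P : PiLp 2 E →L[ℝ] PiLp 2 E | P.toLinearMap ∈ Coupling E K} := by
  refine isCompact_of_isClosed_of_norm_le (X := PiLp 2 E →L[ℝ] PiLp 2 E) ?_
    (∑ i, LinearMap.trace ℝ (E i) (K i)) fun P hP => ?_
  · have : {P : PiLp 2 E →L[ℝ] PiLp 2 E | P.toLinearMap ∈ Coupling E K} =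
        {P : PiLp 2 E →L[ℝ] PiLp 2 E | PosSemidef P.toLinearMap} ∩ ⋂ i, ⋂ v : E i,
          {P : PiLp 2 E →L[ℝ] PiLp 2 E | ⟪P (singleL E i v), singleL E i v⟫ = ⟪K i v, v⟫} := by
      ext P
      simp [Coupling]
    rw [this]
    refine isClosed_posSemidef.inter (isClosed_iInter fun x => isClosed_iInter fun y =>
      isClosed_eq ?_ ?_) <;> fun_prop
  · have h := (mem_coupling_iff E hK).1 hP
    refine h.1.opNorm_le.trans_eq ?_
    rw [trace_eq_sum_trace_block]
    simp only [h.2]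

/-- Semidefinite programming duality for the maximization of a linear functional over
couplings. -/
lemma exists_dual_coupling {K : ∀ i, E i →ₗ[ℝ] E i} (hK : ∀ i, PosDef (K i))
    (W : PiLp 2 E →ₗ[ℝ] PiLp 2 E) (α : ℝ)
    (hα : ∀ P ∈ Coupling E K, LinearMap.trace ℝ _ (W ∘ₗ P) ≤ α) {ε : ℝ} (hε : 0 < ε) :
    ∃ V : ∀ i, E i →ₗ[ℝ] E i, (∀ i, (V i).IsSymmetric) ∧
      (∀ x, ⟪W x, x⟫ ≤ ∑ i, ⟪V i (projL E i x), projL E i x⟫) ∧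
      ∑ i, LinearMap.trace ℝ (E i) (V i ∘ₗ K i) < α + ε := by
  classical
  let L : (PiLp 2 E →L[ℝ] PiLp 2 E) →ₗ[ℝ] (PiLp 2 E →ₗ[ℝ] PiLp 2 E) :=
    ContinuousLinearMap.coeLM ℝ
  let Li : ∀ i, (E i →ₗ[ℝ] E i) →ₗ[ℝ] (E i →L[ℝ] E i) := fun i =>
    LinearMap.toContinuousLinearMap.toLinearMap
  let Φ : (PiLp 2 E →L[ℝ] PiLp 2 E) →ₗ[ℝ] (∀ i, E i →L[ℝ] E i) :=
    LinearMap.pi fun i => Li i ∘ₗ block E i ∘ₗ L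
  let τ : (PiLp 2 E →L[ℝ] PiLp 2 E) →ₗ[ℝ] ℝ :=
    LinearMap.trace ℝ _ ∘ₗ LinearMap.mulLeft ℝ W ∘ₗ L
  let θ : (∀ i, E i →L[ℝ] E i) →ₗ[ℝ] ℝ :=
    ∑ i, LinearMap.trace ℝ (E i) ∘ₗ ContinuousLinearMap.coeLM ℝ ∘ₗ LinearMap.proj i
  have hKs : ∀ i, (K i).IsSymmetric := fun i => (hK i).1
  obtain ⟨f, hf1, hf2⟩ := exists_dual_of_cone Φ τ θ
    {P : PiLp 2 E →L[ℝ] PiLp 2 E | PosSemidef P.toLinearMap} isClosed_posSemidef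
    (fun x hx y hy => by simpa using PosSemidef.add hx hy)
    (fun r hr x hx => by simpa using PosSemidef.smul hx hr)
    (fun P hP => by
      refine hP.opNorm_le.trans_eq ?_
      rw [trace_eq_sum_trace_block]
      simp [θ, Φ, Li, L])
    (fun i => Li i (K i))
    ⟨LinearMap.toContinuousLinearMap (blockSum E K), (blockSum_mem_coupling E hK).1, by
      ext1 i
      exact congrArg (Li i) (block_blockSum E K i)⟩ α
    (fun P hP h => hα _ ((mem_coupling_iff E hKs).2 ⟨hP, fun i =>
      LinearMap.toContinuousLinearMap.injective (congrFun h i)⟩)) hε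
  choose V hVs hV using fun i => exists_symmetric_trace_repr
    (f ∘ₗ LinearMap.single ℝ (fun i => E i →L[ℝ] E i) i ∘ₗ Li i)
  have hfV : ∀ D : ∀ i, E i →ₗ[ℝ] E i, (∀ i, (D i).IsSymmetric) →
      f (fun i => Li i (D i)) = ∑ i, LinearMap.trace ℝ (E i) (V i ∘ₗ D i) := by
    intro D hD
    rw [← Finset.univ_sum_single fun i => Li i (D i), map_sum]
    exact Finset.sum_congr rfl fun i _ => by rw [← hV i _ (hD i)]; rfl
  refine ⟨V, hVs, fun x => ?_, by rwa [← hfV K hKs]⟩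
  have hx : PosSemidef (InnerProductSpace.rankOne ℝ x x).toLinearMap :=
    ⟨InnerProductSpace.isSymmetric_rankOne_self x, fun y => by
      simp [inner_smul_left, mul_self_nonneg]⟩
  have h := hf1 _ hx
  have e1 : Φ (InnerProductSpace.rankOne ℝ x x) =
      fun i => Li i (block E i (InnerProductSpace.rankOne ℝ x x).toLinearMap) := rfl
  have e2 : ∀ i, block E i (InnerProductSpace.rankOne ℝ x x).toLinearMap =
      (InnerProductSpace.rankOne ℝ (projL E i x) (projL E i x)).toLinearMap := fun i => by
    ext v
    simp [block, inner_singleL]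
  have e3 : τ (InnerProductSpace.rankOne ℝ x x) = ⟪W x, x⟫ := by
    have : W * (InnerProductSpace.rankOne ℝ x x).toLinearMap =
        (InnerProductSpace.rankOne ℝ (W x) x).toLinearMap := by
      ext y; simp
    simp only [τ, L, LinearMap.comp_apply, LinearMap.mulLeft_apply,
      ContinuousLinearMap.coeLM_apply]
    rw [this, InnerProductSpace.trace_rankOne, real_inner_comm]
  rw [e1, e3, hfV _ fun i => block_isSymmetric E hx.1 i] at h
  refine h.trans_eq (Finset.sum_congr rfl fun i _ => ?_)
  have : V i ∘ₗ (InnerProductSpace.rankOne ℝ (projL E i x) (projL E i x)).toLinearMap =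
      (InnerProductSpace.rankOne ℝ (V i (projL E i x)) (projL E i x)).toLinearMap := by
    ext y; simp
  rw [e2, this, InnerProductSpace.trace_rankOne, real_inner_comm]

end Blocks

section Sandwich

variable {X : Type*} [NormedAddCommGroup X] [InnerProductSpace ℝ X] [FiniteDimensional ℝ X]

lemma PosSemidef.sandwich {H : Type*} [NormedAddCommGroup H] [InnerProductSpace ℝ H]
    [FiniteDimensional ℝ H] {P : X →ₗ[ℝ] X} (hP : PosSemidef P) (Q : X →ₗ[ℝ] H) :
    PosSemidef (Q ∘ₗ P ∘ₗ LinearMap.adjoint Q) :=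
  ⟨fun x y => by
    simp only [LinearMap.comp_apply]
    rw [← LinearMap.adjoint_inner_right, hP.1, LinearMap.adjoint_inner_left], fun x => by
    simp only [LinearMap.comp_apply]
    rw [← LinearMap.adjoint_inner_right]
    exact hP.2 _⟩

/-- A positive definite operator has a positive definite inverse. -/
lemma PosDef.exists_inverse {A : X →ₗ[ℝ] X} (hA : PosDef A) :
    ∃ A' : X →ₗ[ℝ] X, PosDef A' ∧ A' ∘ₗ A = LinearMap.id ∧ A ∘ₗ A' = LinearMap.id := by
  let e := LinearMap.equivOfDetNeZero A hA.det_pos.ne'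
  have he : ∀ x, A (e.symm x) = x := e.apply_symm_apply
  refine ⟨e.symm, ⟨fun x y => ?_, fun x hx => ?_⟩, LinearMap.ext e.symm_apply_apply,
    LinearMap.ext he⟩
  · have := hA.1 (e.symm x) (e.symm y)
    rw [he, he] at this
    exact this.symm
  · have := hA.2 (e.symm x) (by simpa using hx)
    rw [he, real_inner_comm] at this
    exact this

variable {m : ℕ} {F : Fin m → Type*}
  [∀ j, NormedAddCommGroup (F j)] [∀ j, InnerProductSpace ℝ (F j)]
  [∀ j, FiniteDimensional ℝ (F j)]

/-- The pulled-back operator `∑ⱼ dⱼ Qⱼ* Uⱼ Qⱼ`. -/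
def pullback (d : Fin m → ℝ) (Q : ∀ j, X →ₗ[ℝ] F j) (U : ∀ j, F j →ₗ[ℝ] F j) : X →ₗ[ℝ] X :=
  ∑ j, d j • (LinearMap.adjoint (Q j) ∘ₗ U j ∘ₗ Q j)

variable (d : Fin m → ℝ) (Q : ∀ j, X →ₗ[ℝ] F j) (U : ∀ j, F j →ₗ[ℝ] F j)

lemma inner_pullback (x y : X) :
    ⟪pullback d Q U x, y⟫ = ∑ j, d j * ⟪U j (Q j x), Q j y⟫ := by
  simp [pullback, LinearMap.sum_apply, sum_inner, inner_smul_left, LinearMap.adjoint_inner_left]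

lemma pullback_posSemidef (hd : ∀ j, 0 < d j) (hU : ∀ j, PosDef (U j)) :
    PosSemidef (pullback d Q U) := by
  refine ⟨fun x y => ?_, fun x => ?_⟩
  · rw [inner_pullback, real_inner_comm, inner_pullback]
    exact Finset.sum_congr rfl fun j _ => by rw [(hU j).1, real_inner_comm]
  · rw [inner_pullback]
    exact Finset.sum_nonneg fun j _ => mul_nonneg (hd j).le ((hU j).posSemidef.2 _)

lemma trace_pullback_comp (P : X →ₗ[ℝ] X) :
    LinearMap.trace ℝ X (pullback d Q U ∘ₗ P) =
      ∑ j, d j * LinearMap.trace ℝ (F j) (U j ∘ₗ Q j ∘ₗ P ∘ₗ LinearMap.adjoint (Q j)) := by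
  rw [pullback, ← Module.End.mul_eq_comp, Finset.sum_mul, map_sum]
  refine Finset.sum_congr rfl fun j _ => ?_
  rw [smul_mul_assoc, map_smul, smul_eq_mul, Module.End.mul_eq_comp, LinearMap.comp_assoc,
    LinearMap.trace_comp_comm']
  simp only [LinearMap.comp_assoc]

/-- First-order optimality condition for a maximizer of `∑ⱼ dⱼ log det (Qⱼ P Qⱼ*)` on a convex
set. -/
lemma trace_pullback_le_of_isMax {d : Fin m → ℝ} {Q : ∀ j, X →ₗ[ℝ] F j}
    {U : ∀ j, F j →ₗ[ℝ] F j} {C : Set (X →ₗ[ℝ] X)} (hC : Convex ℝ C) {P₀ : X →ₗ[ℝ] X}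
    (hP₀ : P₀ ∈ C)
    (hpos : ∀ j, 0 < LinearMap.det (Q j ∘ₗ P₀ ∘ₗ LinearMap.adjoint (Q j)))
    (hU : ∀ j, (Q j ∘ₗ P₀ ∘ₗ LinearMap.adjoint (Q j)) ∘ₗ U j = LinearMap.id)
    (hmax : ∀ P ∈ C, (∀ j, 0 < LinearMap.det (Q j ∘ₗ P ∘ₗ LinearMap.adjoint (Q j))) →
      ∑ j, d j * Real.log (LinearMap.det (Q j ∘ₗ P ∘ₗ LinearMap.adjoint (Q j))) ≤
        ∑ j, d j * Real.log (LinearMap.det (Q j ∘ₗ P₀ ∘ₗ LinearMap.adjoint (Q j))))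
    {P : X →ₗ[ℝ] X} (hP : P ∈ C) :
    LinearMap.trace ℝ X (pullback d Q U ∘ₗ P) ≤ LinearMap.trace ℝ X (pullback d Q U ∘ₗ P₀) := by
  let N : ∀ j, F j →ₗ[ℝ] F j := fun j => U j ∘ₗ Q j ∘ₗ (P - P₀) ∘ₗ LinearMap.adjoint (Q j)
  have hder : HasDerivAt (fun t : ℝ => ∑ j, d j *
      Real.log (LinearMap.det (LinearMap.id + t • N j)))
      (∑ j, d j * LinearMap.trace ℝ (F j) (N j)) 0 :=
    HasDerivAt.fun_sum fun j _ => (hasDerivAt_log_det_one_add (N j)).const_mul (d j)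
  have hle : ∑ j, d j * LinearMap.trace ℝ (F j) (N j) ≤ 0 := by
    refine le_of_tendsto hder.tendsto_slope_zero_right ?_
    have h1 : ∀ᶠ t : ℝ in nhds 0, ∀ j, 0 < LinearMap.det (LinearMap.id + t • N j) :=
      Filter.eventually_all.2 fun j =>
        (hasDerivAt_det_one_add (N j)).continuousAt.eventually_const_lt (by simp)
    filter_upwards [self_mem_nhdsWithin, h1.filter_mono nhdsWithin_le_nhds,
      (eventually_lt_nhds (zero_lt_one' ℝ)).filter_mono nhdsWithin_le_nhds] with t ht0 ht ht1
    rw [Set.mem_Ioi] at ht0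
    have hdet : ∀ j, LinearMap.det (Q j ∘ₗ (P₀ + t • (P - P₀)) ∘ₗ LinearMap.adjoint (Q j)) =
        LinearMap.det (Q j ∘ₗ P₀ ∘ₗ LinearMap.adjoint (Q j)) *
          LinearMap.det (LinearMap.id + t • N j) := fun j => by
      rw [← LinearMap.det_comp, LinearMap.comp_add, LinearMap.comp_id, LinearMap.comp_smul]
      simp only [N]
      rw [← LinearMap.comp_assoc _ (U j), hU, LinearMap.id_comp, LinearMap.add_comp,
        LinearMap.comp_add, LinearMap.smul_comp, LinearMap.comp_smul]
    have hlog := hmax _ (hC.add_smul_sub_mem hP₀ hP ⟨ht0.le, ht1.le⟩) fun j => by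
      rw [hdet]; exact mul_pos (hpos j) (ht j)
    simp only [hdet, Real.log_mul (hpos _).ne' (ht _).ne', mul_add, Finset.sum_add_distrib]
      at hlog
    have : ∑ j, d j * Real.log (LinearMap.det (LinearMap.id + t • N j)) ≤ 0 := by linarith
    simpa using mul_nonpos_of_nonneg_of_nonpos (inv_nonneg.2 ht0.le) this
  rw [← trace_pullback_comp, LinearMap.comp_sub, map_sub] at hle
  linarith

/-- `∑ⱼ dⱼ log det (Qⱼ P Qⱼ*)` attains its maximum on a compact set as soon as it is finite
somewhere. -/
lemma exists_isMax_log_det {d : Fin m → ℝ} (hd : ∀ j, 0 < d j) (Q : ∀ j, X →ₗ[ℝ] F j)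
    {C : Set (X →ₗ[ℝ] X)} (hC : IsCompact {P : X →L[ℝ] X | P.toLinearMap ∈ C})
    (hCpos : ∀ P ∈ C, PosSemidef P)
    (hne : ∃ P ∈ C, ∀ j, 0 < LinearMap.det (Q j ∘ₗ P ∘ₗ LinearMap.adjoint (Q j))) :
    ∃ P₀ ∈ C, (∀ j, 0 < LinearMap.det (Q j ∘ₗ P₀ ∘ₗ LinearMap.adjoint (Q j))) ∧
      ∀ P ∈ C, (∀ j, 0 < LinearMap.det (Q j ∘ₗ P ∘ₗ LinearMap.adjoint (Q j))) →
        ∑ j, d j * Real.log (LinearMap.det (Q j ∘ₗ P ∘ₗ LinearMap.adjoint (Q j))) ≤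
          ∑ j, d j * Real.log (LinearMap.det (Q j ∘ₗ P₀ ∘ₗ LinearMap.adjoint (Q j))) := by
  obtain ⟨P₁, hP₁, hpos₁⟩ := hne
  let M : (X →ₗ[ℝ] X) → ∀ j, F j →ₗ[ℝ] F j := fun P j => Q j ∘ₗ P ∘ₗ LinearMap.adjoint (Q j)
  let G : (X →L[ℝ] X) → ℝ := fun P => ∏ j, LinearMap.det (M P.toLinearMap j) ^ d j
  have hcont : Continuous G := by
    refine continuous_finsetProd _ fun j _ => Continuous.rpow_const ?_ fun _ => .inr (hd j).le
    have h1 : Continuous fun P : X →L[ℝ] X =>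
        LinearMap.toContinuousLinearMap (Q j) ∘L P ∘L
          LinearMap.toContinuousLinearMap (LinearMap.adjoint (Q j)) := by fun_prop
    exact ContinuousLinearMap.continuous_det.comp h1
  have hexp : ∀ P, (∀ j, 0 < LinearMap.det (M P j)) →
      ∏ j, LinearMap.det (M P j) ^ d j = Real.exp (∑ j, d j * Real.log (LinearMap.det (M P j))) :=
    fun P hP => by
      rw [Real.exp_sum]
      exact Finset.prod_congr rfl fun j _ => by rw [Real.rpow_def_of_pos (hP j), mul_comm]
  obtain ⟨P₀, hP₀, hmax⟩ := hC.exists_isMaxOn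
    ⟨LinearMap.toContinuousLinearMap P₁, by simpa using hP₁⟩ hcont.continuousOn
  have hmax' : ∀ P ∈ C, ∏ j, LinearMap.det (M P j) ^ d j ≤
      ∏ j, LinearMap.det (M P₀.toLinearMap j) ^ d j := fun P hP =>
    hmax (show LinearMap.toContinuousLinearMap P ∈ _ by simpa using hP)
  have hnn : ∀ j, 0 ≤ LinearMap.det (M P₀.toLinearMap j) := fun j =>
    ((hCpos _ hP₀).sandwich (Q j)).det_nonneg
  have hpos₀ : ∀ j, 0 < LinearMap.det (M P₀.toLinearMap j) := fun j => by
    refine (hnn j).lt_of_ne fun h0 => ?_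
    have h1 := hmax' P₁ hP₁
    rw [hexp P₁ hpos₁, Finset.prod_eq_zero (Finset.mem_univ j)
      (by rw [← h0, Real.zero_rpow (hd j).ne'])] at h1
    exact (Real.exp_pos _).not_ge h1
  refine ⟨P₀.toLinearMap, hP₀, hpos₀, fun P hP hpos => Real.exp_le_exp.1 ?_⟩
  rw [← hexp P hpos, ← hexp _ hpos₀]
  exact hmax' P hP

end Sandwich

section EReal

variable {m : ℕ} {F : Fin m → Type*} [∀ j, AddCommGroup (F j)] [∀ j, Module ℝ (F j)]
  {d : Fin m → ℝ} {M : ∀ j, F j →ₗ[ℝ] F j}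

lemma sum_elogdet_of_pos (h : ∀ j, 0 < LinearMap.det (M j)) :
    ∑ j, (d j : EReal) * elogdet (M j) =
      ((∑ j, d j * Real.log (LinearMap.det (M j)) : ℝ) : EReal) := by
  let φ : ℝ →+ EReal := ⟨⟨Real.toEReal, EReal.coe_zero⟩, EReal.coe_add⟩
  refine .trans (Finset.sum_congr rfl fun j _ => ?_) (map_sum φ _ _).symm
  rw [elogdet, if_pos (h j)]
  exact (EReal.coe_mul _ _).symm

lemma sum_elogdet_eq_bot (hd : ∀ j, 0 < d j) (h : ¬ ∀ j, 0 < LinearMap.det (M j)) :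
    ∑ j, (d j : EReal) * elogdet (M j) = ⊥ := by
  push Not at h
  obtain ⟨j, hj⟩ := h
  rw [← Finset.add_sum_erase _ _ (Finset.mem_univ j), elogdet, if_neg hj.not_gt,
    EReal.coe_mul_bot_of_pos (hd j), EReal.bot_add]

end EReal

section Duality

variable {k m : ℕ} (E : Fin k → Type*) (F : Fin m → Type*)
  [∀ i, NormedAddCommGroup (E i)] [∀ i, InnerProductSpace ℝ (E i)]
  [∀ j, NormedAddCommGroup (F j)] [∀ j, InnerProductSpace ℝ (F j)]
  (c : Fin k → ℝ) (d : Fin m → ℝ) (B : ∀ i j, E i →ₗ[ℝ] F j)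

lemma BLam_apply (j : Fin m) (x : PiLp 2 E) :
    BLam E F c B j x = ∑ i, c i • B i j (projL E i x) := by
  have hLam : Lam E c = blockSum E fun i => c i • LinearMap.id := by
    simp only [Lam, blockSum, LinearMap.smul_comp, LinearMap.comp_smul, LinearMap.id_comp]
  rw [BLam, LinearMap.comp_apply, Bop, LinearMap.sum_apply, hLam]
  exact Finset.sum_congr rfl fun i _ => by
    rw [LinearMap.comp_apply, projL_blockSum, LinearMap.smul_apply, map_smul, LinearMap.id_apply]

lemma convex_coupling (K : ∀ i, E i →ₗ[ℝ] E i) : Convex ℝ (Coupling E K) := by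
  intro P hP P' hP' a b ha hb hab
  refine ⟨(hP.1.smul ha).add (hP'.1.smul hb), fun i v => ?_⟩
  rw [LinearMap.add_apply, LinearMap.smul_apply, LinearMap.smul_apply, inner_add_left,
    inner_smul_left, inner_smul_left, hP.2, hP'.2, ← add_mul]
  simp [hab]

variable [∀ i, FiniteDimensional ℝ (E i)] [∀ j, FiniteDimensional ℝ (F j)]

lemma gaussCon_iff (V : ∀ i, E i →ₗ[ℝ] E i) (U : ∀ j, F j →ₗ[ℝ] F j) :
    GaussCon E F c d B V U ↔ ∀ x, ⟪pullback d (BLam E F c B) U x, x⟫ ≤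
      ⟪blockSum E (fun i => c i • V i) x, x⟫ := by
  simp only [inner_pullback, BLam_apply, inner_blockSum, LinearMap.smul_apply, inner_smul_left,
    RCLike.conj_to_real]
  exact ⟨fun h x => h fun i => projL E i x, fun h x => h (WithLp.toLp 2 x)⟩

variable {E F c d B} {K : ∀ i, E i →ₗ[ℝ] E i}

lemma weak_duality (hd : ∀ j, 0 < d j) (hK : ∀ i, PosDef (K i)) {P : PiLp 2 E →ₗ[ℝ] PiLp 2 E}
    (hP : P ∈ Coupling E K)
    (hdet : ∀ j, 0 < LinearMap.det (BLam E F c B j ∘ₗ P ∘ₗ LinearMap.adjoint (BLam E F c B j)))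
    {V : ∀ i, E i →ₗ[ℝ] E i} {U : ∀ j, F j →ₗ[ℝ] F j} (hV : ∀ i, PosDef (V i))
    (hU : ∀ j, PosDef (U j)) (h : GaussCon E F c d B V U) :
    ∑ j, d j * Real.log (LinearMap.det
        (BLam E F c B j ∘ₗ P ∘ₗ LinearMap.adjoint (BLam E F c B j))) +
      ∑ j, d j * (Module.finrank ℝ (F j) : ℝ) ≤
    ∑ i, c i * LinearMap.trace ℝ (E i) (V i ∘ₗ K i) -
      ∑ j, d j * Real.log (LinearMap.det (U j)) := by
  rw [gaussCon_iff] at h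
  have hP' := (mem_coupling_iff E fun i => (hK i).1).1 hP
  have hΘ : PosSemidef (blockSum E (fun i => c i • V i) - pullback d (BLam E F c B) U) := by
    refine ⟨.sub (fun x y => ?_) (pullback_posSemidef d _ U hd hU).1, fun x => ?_⟩
    · rw [inner_blockSum, real_inner_comm, inner_blockSum]
      refine Finset.sum_congr rfl fun i _ => ?_
      rw [LinearMap.smul_apply, LinearMap.smul_apply, inner_smul_left, inner_smul_left, (hV i).1,
        real_inner_comm]
    · rw [LinearMap.sub_apply, inner_sub_left]
      exact sub_nonneg.2 (h x)
  have htr := hΘ.trace_comp_nonneg hP'.1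
  rw [LinearMap.sub_comp, map_sub, trace_blockSum_comp, trace_pullback_comp] at htr
  simp only [hP'.2, LinearMap.smul_comp, map_smul, smul_eq_mul] at htr
  have hlog := Finset.sum_le_sum fun j (_ : j ∈ Finset.univ) => mul_le_mul_of_nonneg_left
    (log_det_add_log_det_le (hU j) (hP'.1.sandwich (BLam E F c B j)) (hdet j)) (hd j).le
  simp only [mul_add, mul_sub, Finset.sum_add_distrib, Finset.sum_sub_distrib] at hlog
  linarith

/-- At a maximizing coupling there is no duality gap. -/
lemma exists_gaussCon_le_of_isMax (hc : ∀ i, 0 < c i) (hd : ∀ j, 0 < d j)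
    (hK : ∀ i, PosDef (K i)) {P₀ : PiLp 2 E →ₗ[ℝ] PiLp 2 E} (hP₀ : P₀ ∈ Coupling E K)
    (hpos : ∀ j, 0 < LinearMap.det
      (BLam E F c B j ∘ₗ P₀ ∘ₗ LinearMap.adjoint (BLam E F c B j)))
    (hmax : ∀ P ∈ Coupling E K,
      (∀ j, 0 < LinearMap.det (BLam E F c B j ∘ₗ P ∘ₗ LinearMap.adjoint (BLam E F c B j))) →
      ∑ j, d j * Real.log (LinearMap.det
        (BLam E F c B j ∘ₗ P ∘ₗ LinearMap.adjoint (BLam E F c B j))) ≤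
      ∑ j, d j * Real.log (LinearMap.det
        (BLam E F c B j ∘ₗ P₀ ∘ₗ LinearMap.adjoint (BLam E F c B j))))
    {ε : ℝ} (hε : 0 < ε) :
    ∃ (V : ∀ i, E i →ₗ[ℝ] E i) (U : ∀ j, F j →ₗ[ℝ] F j),
      (∀ i, PosDef (V i)) ∧ (∀ j, PosDef (U j)) ∧ GaussCon E F c d B V U ∧
      ∑ i, c i * LinearMap.trace ℝ (E i) (V i ∘ₗ K i) -
          ∑ j, d j * Real.log (LinearMap.det (U j)) ≤
        ∑ j, d j * Real.log (LinearMap.det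
          (BLam E F c B j ∘ₗ P₀ ∘ₗ LinearMap.adjoint (BLam E F c B j))) +
        ∑ j, d j * (Module.finrank ℝ (F j) : ℝ) + ε := by
  choose U hU hUM hMU using fun j =>
    ((hP₀.1.sandwich (BLam E F c B j)).posDef_of_det_pos (hpos j)).exists_inverse
  set W := pullback d (BLam E F c B) U with hW
  have hWpos : PosSemidef W := pullback_posSemidef d _ U hd hU
  have htr : LinearMap.trace ℝ _ (W ∘ₗ P₀) = ∑ j, d j * (Module.finrank ℝ (F j) : ℝ) := by
    rw [hW, trace_pullback_comp]
    exact Finset.sum_congr rfl fun j _ => by rw [hUM, LinearMap.trace_id]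
  have hlog : ∀ j, Real.log (LinearMap.det (U j)) = -Real.log (LinearMap.det
      (BLam E F c B j ∘ₗ P₀ ∘ₗ LinearMap.adjoint (BLam E F c B j))) := fun j => by
    rw [eq_neg_iff_add_eq_zero, ← Real.log_mul (hU j).det_pos.ne' (hpos j).ne',
      ← LinearMap.det_comp, hUM, LinearMap.det_id, Real.log_one]
  obtain ⟨V, hV, hWV, hVK⟩ := exists_dual_coupling E hK W _
    (fun P hP => trace_pullback_le_of_isMax (convex_coupling E K) hP₀ hpos hMU hmax hP)
    (half_pos hε)
  rw [htr] at hVK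
  have hVnn : ∀ i v, 0 ≤ ⟪V i v, v⟫ := fun i v => by
    have h1 := (hWpos.2 (singleL E i v)).trans (hWV (singleL E i v))
    rw [← inner_blockSum, inner_singleL] at h1
    rwa [← block_blockSum E V i]
  have hKnn : ∀ i, 0 ≤ LinearMap.trace ℝ (E i) (K i) := fun i => by
    simpa using PosSemidef.trace_comp_nonneg (A := LinearMap.id)
      ⟨LinearMap.IsSymmetric.id, fun x => real_inner_self_nonneg⟩ (hK i).posSemidef
  set T := ∑ i, LinearMap.trace ℝ (E i) (K i)
  have hT : 0 ≤ T := Finset.sum_nonneg fun i _ => hKnn i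
  set δ := ε / 2 / (T + 1) with hδ
  have hδ0 : 0 < δ := by positivity
  have hδT : δ * T ≤ ε / 2 := by
    rw [hδ, div_mul_eq_mul_div, div_le_iff₀ (by positivity)]
    nlinarith
  refine ⟨fun i => (c i)⁻¹ • (V i + δ • LinearMap.id), U, fun i => ⟨fun x y => ?_, fun x hx => ?_⟩,
    hU, (gaussCon_iff E F c d B _ U).2 fun x => ?_, ?_⟩
  · simp [inner_add_left, inner_add_right, inner_smul_left, inner_smul_right, hV i x y]
  · have h1 : 0 < ⟪x, x⟫ := real_inner_self_pos.2 hx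
    have h2 := hVnn i x
    have h3 := inv_pos.2 (hc i)
    simp only [LinearMap.smul_apply, LinearMap.add_apply, LinearMap.id_apply, inner_smul_left,
      inner_add_left, RCLike.conj_to_real]
    positivity
  · refine (hWV x).trans ?_
    rw [inner_blockSum]
    refine Finset.sum_le_sum fun i _ => ?_
    rw [smul_smul, mul_inv_cancel₀ (hc i).ne', one_smul, LinearMap.add_apply, inner_add_left,
      LinearMap.smul_apply, inner_smul_left, LinearMap.id_apply]
    exact le_add_of_nonneg_right (mul_nonneg hδ0.le real_inner_self_nonneg)
  · have h1 : ∑ i, c i * LinearMap.trace ℝ (E i) (((c i)⁻¹ • (V i + δ • LinearMap.id)) ∘ₗ K i) =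
        ∑ i, LinearMap.trace ℝ (E i) (V i ∘ₗ K i) + δ * T := by
      rw [Finset.mul_sum, ← Finset.sum_add_distrib]
      refine Finset.sum_congr rfl fun i _ => ?_
      rw [LinearMap.smul_comp, map_smul, smul_eq_mul, mul_inv_cancel_left₀ (hc i).ne',
        LinearMap.add_comp, map_add, LinearMap.smul_comp, map_smul, LinearMap.id_comp, smul_eq_mul]
    simp only [hlog, mul_neg, Finset.sum_neg_distrib]
    linarith

/-- If some `Λ_c B_j*` has a kernel, then the dual problem is unbounded below. -/
lemma exists_gaussCon_le_of_adjoint_eq_zero (hc : ∀ i, 0 < c i) (hd : ∀ j, 0 < d j)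
    {j₀ : Fin m} {y : F j₀} (hy : y ≠ 0) (hQy : LinearMap.adjoint (BLam E F c B j₀) y = 0)
    (r : ℝ) :
    ∃ (V : ∀ i, E i →ₗ[ℝ] E i) (U : ∀ j, F j →ₗ[ℝ] F j),
      (∀ i, PosDef (V i)) ∧ (∀ j, PosDef (U j)) ∧ GaussCon E F c d B V U ∧
      ∑ i, c i * LinearMap.trace ℝ (E i) (V i ∘ₗ K i) -
          ∑ j, d j * Real.log (LinearMap.det (U j)) ≤ r := by
  classical
  have hid : ∀ j, PosDef (LinearMap.id : F j →ₗ[ℝ] F j) := fun j =>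
    ⟨LinearMap.IsSymmetric.id, fun x hx => real_inner_self_pos.2 hx⟩
  set W := pullback d (BLam E F c B) fun _ => LinearMap.id with hW
  have hWpos : PosSemidef W := pullback_posSemidef d _ _ hd hid
  set τ := LinearMap.trace ℝ _ W + 1 with hτ
  have hτ0 : 0 < τ := by
    have := PosSemidef.trace_comp_nonneg (A := LinearMap.id)
      ⟨LinearMap.IsSymmetric.id, fun x => real_inner_self_nonneg⟩ hWpos
    rw [LinearMap.id_comp] at this
    positivity
  let V : ∀ i, E i →ₗ[ℝ] E i := fun i => ((c i)⁻¹ * τ) • LinearMap.id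
  set A := ∑ i, c i * LinearMap.trace ℝ (E i) (V i ∘ₗ K i)
  have hy2 : 0 < ⟪y, y⟫ := real_inner_self_pos.2 hy
  set s := Real.exp ((A - r) / d j₀) / ⟪y, y⟫ with hs
  have hs0 : 0 < s := by positivity
  let N : F j₀ →ₗ[ℝ] F j₀ := LinearMap.transvection (innerₛₗ ℝ y) (s • y)
  have hN : ∀ v, N v = v + (⟪y, v⟫ * s) • y := fun v => by
    simp [N, LinearMap.transvection.apply, smul_smul]
  let U : ∀ j, F j →ₗ[ℝ] F j := Function.update (fun _ => LinearMap.id) j₀ N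
  have hU : ∀ j, PosDef (U j) := fun j => by
    rcases eq_or_ne j j₀ with rfl | hj
    · rw [show U j = N from Function.update_self ..]
      refine ⟨fun v w => ?_, fun v hv => ?_⟩
      · simp only [hN, inner_add_left, inner_add_right, inner_smul_left, inner_smul_right,
          RCLike.conj_to_real, real_inner_comm v y]
        ring
      · rw [hN, inner_add_left, inner_smul_left]
        have h1 : 0 < ⟪v, v⟫ := real_inner_self_pos.2 hv
        have h2 : 0 ≤ s * (⟪y, v⟫ * ⟪y, v⟫) := mul_nonneg hs0.le (mul_self_nonneg _)
        simp only [RCLike.conj_to_real]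
        linarith
    · rw [show U j = LinearMap.id from Function.update_of_ne hj ..]
      exact hid j
  have hQ : ∀ x, ⟪y, BLam E F c B j₀ x⟫ = 0 := fun x => by
    rw [← LinearMap.adjoint_inner_left, hQy, inner_zero_left]
  have hUQ : ∀ j x, U j (BLam E F c B j x) = BLam E F c B j x := fun j x => by
    rcases eq_or_ne j j₀ with rfl | hj
    · rw [show U j = N from Function.update_self .., hN, hQ, zero_mul, zero_smul, add_zero]
    · rw [show U j = LinearMap.id from Function.update_of_ne hj .., LinearMap.id_apply]
  have hlog : (A - r) ≤ ∑ j, d j * Real.log (LinearMap.det (U j)) := by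
    rw [Finset.sum_eq_single j₀ (fun j _ hj => by
      rw [show U j = LinearMap.id from Function.update_of_ne hj .., LinearMap.det_id,
        Real.log_one, mul_zero]) (by simp), show U j₀ = N from Function.update_self ..,
      LinearMap.transvection.det, ← div_le_iff₀' (hd j₀)]
    rw [Real.le_log_iff_exp_le (by simp; positivity)]
    have h1 : ⟪y, s • y⟫ = Real.exp ((A - r) / d j₀) := by
      rw [inner_smul_right, hs, div_mul_cancel₀ _ hy2.ne']
    rw [innerₛₗ_apply_apply, h1]
    linarith
  refine ⟨V, U, fun i => ⟨fun x z => ?_, fun x hx => ?_⟩, hU,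
    (gaussCon_iff E F c d B V U).2 fun x => ?_, by linarith⟩
  · simp [V, inner_smul_left, inner_smul_right]
  · have h1 : 0 < ⟪x, x⟫ := real_inner_self_pos.2 hx
    have h2 := inv_pos.2 (hc i)
    simp only [V, LinearMap.smul_apply, LinearMap.id_apply, inner_smul_left, RCLike.conj_to_real]
    positivity
  · have h1 : ⟪pullback d (BLam E F c B) U x, x⟫ = ⟪W x, x⟫ := by
      simp [hW, inner_pullback, hUQ]
    have h2 : ⟪blockSum E (fun i => c i • V i) x, x⟫ = τ * ‖x‖ ^ 2 := by
      rw [← real_inner_self_eq_norm_sq, inner_blockSum, PiLp.inner_apply, Finset.mul_sum]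
      refine Finset.sum_congr rfl fun i _ => ?_
      simp only [V, smul_smul, mul_inv_cancel_left₀ (hc i).ne', LinearMap.smul_apply,
        LinearMap.id_apply, inner_smul_left, RCLike.conj_to_real, projL_apply]
    rw [h1, h2]
    refine (hWpos.inner_le_trace x).trans ?_
    gcongr
    linarith

/-- If no coupling makes all `B_j Λ_c P Λ_c B_j*` nonsingular, then some `Λ_c B_j*` has a
kernel. -/
lemma exists_adjoint_eq_zero (hK : ∀ i, PosDef (K i))
    (h : ¬ ∃ P ∈ Coupling E K, ∀ j, 0 < LinearMap.det
      (BLam E F c B j ∘ₗ P ∘ₗ LinearMap.adjoint (BLam E F c B j))) :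
    ∃ (j : Fin m) (y : F j), y ≠ 0 ∧ LinearMap.adjoint (BLam E F c B j) y = 0 := by
  by_contra! hinj
  refine h ⟨blockSum E K, blockSum_mem_coupling E hK, fun j => PosDef.det_pos
    ⟨((blockSum_mem_coupling E hK).1.sandwich (BLam E F c B j)).1, fun y hy => ?_⟩⟩
  have hx := hinj j y hy
  rw [LinearMap.comp_apply, LinearMap.comp_apply, ← LinearMap.adjoint_inner_right, inner_blockSum]
  obtain ⟨i, hi⟩ : ∃ i, projL E i (LinearMap.adjoint (BLam E F c B j) y) ≠ 0 := by
    by_contra! h0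
    exact hx (PiLp.ext h0)
  exact Finset.sum_pos' (fun i _ => (hK i).posSemidef.2 _) ⟨i, Finset.mem_univ i, (hK i).2 _ hi⟩

end Duality

end FRBL

namespace FRBL

variable {k m : ℕ}
  (E : Fin k → Type*) (F : Fin m → Type*)
  [∀ i, NormedAddCommGroup (E i)] [∀ i, InnerProductSpace ℝ (E i)]
  [∀ i, FiniteDimensional ℝ (E i)]
  [∀ i, MeasurableSpace (E i)] [∀ i, BorelSpace (E i)]
  [∀ j, NormedAddCommGroup (F j)] [∀ j, InnerProductSpace ℝ (F j)]
  [∀ j, FiniteDimensional ℝ (F j)]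
  [∀ j, MeasurableSpace (F j)] [∀ j, BorelSpace (F j)]

/-- **Theorem (strong min-max duality).** For positive-definite `Kᵢ` on `Eᵢ`,
`max_{K ∈ Π(K₁,…,K_k)} ∑ⱼ dⱼ log det (B_j Λ_c K Λ_c B_j*) + ∑ⱼ dⱼ dim E^j`
(the maximum being attained) equals the infimum over admissible `(Vᵢ), (Uⱼ)` of
`∑ᵢ cᵢ ⟨Vᵢ, Kᵢ⟩_HS − ∑ⱼ dⱼ log det Uⱼ`. -/
theorem strong_min_max
    (c : Fin k → ℝ) (d : Fin m → ℝ) (B : ∀ i j, E i →ₗ[ℝ] F j)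
    (hc : ∀ i, 0 < c i) (hd : ∀ j, 0 < d j)
    (K : ∀ i, E i →ₗ[ℝ] E i) (hK : ∀ i, PosDef (K i)) :
    (∃ P ∈ Coupling E K,
      (∑ j, (d j : EReal) *
          elogdet ((BLam E F c B j) ∘ₗ P ∘ₗ LinearMap.adjoint (BLam E F c B j))) =
        sSup {x : EReal | ∃ P' ∈ Coupling E K,
          x = ∑ j, (d j : EReal) *
            elogdet ((BLam E F c B j) ∘ₗ P' ∘ₗ LinearMap.adjoint (BLam E F c B j))}) ∧
    sSup {x : EReal | ∃ P' ∈ Coupling E K,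
        x = ∑ j, (d j : EReal) *
          elogdet ((BLam E F c B j) ∘ₗ P' ∘ₗ LinearMap.adjoint (BLam E F c B j))} +
      ((∑ j, d j * (Module.finrank ℝ (F j) : ℝ) : ℝ) : EReal) =
    sInf {x : EReal | ∃ (V : ∀ i, E i →ₗ[ℝ] E i) (U : ∀ j, F j →ₗ[ℝ] F j),
      (∀ i, PosDef (V i)) ∧ (∀ j, PosDef (U j)) ∧ GaussCon E F c d B V U ∧
      x = ((∑ i, c i * LinearMap.trace ℝ (E i) ((V i) ∘ₗ (K i)) -
            ∑ j, d j * Real.log (LinearMap.det (U j)) : ℝ) : EReal)} := by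
  set S := {x : EReal | ∃ P' ∈ Coupling E K, x = ∑ j, (d j : EReal) *
    elogdet ((BLam E F c B j) ∘ₗ P' ∘ₗ LinearMap.adjoint (BLam E F c B j))}
  by_cases hne : ∃ P ∈ Coupling E K, ∀ j, 0 < LinearMap.det
      (BLam E F c B j ∘ₗ P ∘ₗ LinearMap.adjoint (BLam E F c B j))
  · obtain ⟨P₀, hP₀, hpos, hmax⟩ := exists_isMax_log_det hd (BLam E F c B)
      (isCompact_coupling E fun i => (hK i).1) (fun P hP => hP.1) hne
    have hval := sum_elogdet_of_pos (d := d) hpos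
    have hsup : sSup S = ((∑ j, d j * Real.log (LinearMap.det
        (BLam E F c B j ∘ₗ P₀ ∘ₗ LinearMap.adjoint (BLam E F c B j))) : ℝ) : EReal) := by
      refine le_antisymm (sSup_le ?_) (le_sSup ⟨P₀, hP₀, hval.symm⟩)
      rintro _ ⟨P, hP, rfl⟩
      by_cases hPpos : ∀ j, 0 < LinearMap.det
          (BLam E F c B j ∘ₗ P ∘ₗ LinearMap.adjoint (BLam E F c B j))
      · rw [sum_elogdet_of_pos hPpos]
        exact EReal.coe_le_coe_iff.2 (hmax P hP hPpos)
      · rw [sum_elogdet_eq_bot hd hPpos]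
        exact bot_le
    refine ⟨⟨P₀, hP₀, hval.trans hsup.symm⟩, ?_⟩
    rw [hsup, ← EReal.coe_add]
    refine le_antisymm (le_sInf ?_) (EReal.le_of_forall_lt_iff_le.1 fun z hz => ?_)
    · rintro _ ⟨V, U, hV, hU, h, rfl⟩
      exact EReal.coe_le_coe_iff.2 (weak_duality hd hK hP₀ hpos hV hU h)
    · rw [EReal.coe_lt_coe_iff] at hz
      obtain ⟨V, U, hV, hU, h, hle⟩ :=
        exists_gaussCon_le_of_isMax hc hd hK hP₀ hpos hmax (sub_pos.2 hz)
      exact sInf_le_of_le ⟨V, U, hV, hU, h, rfl⟩ (EReal.coe_le_coe_iff.2 (by linarith))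
  · have hval : ∀ P ∈ Coupling E K, ∑ j, (d j : EReal) * elogdet
        ((BLam E F c B j) ∘ₗ P ∘ₗ LinearMap.adjoint (BLam E F c B j)) = ⊥ := fun P hP =>
      sum_elogdet_eq_bot hd fun h => hne ⟨P, hP, h⟩
    have hsup : sSup S = ⊥ := by
      refine sSup_eq_bot.2 ?_
      rintro _ ⟨P, hP, rfl⟩
      exact hval P hP
    have hP := blockSum_mem_coupling E hK
    refine ⟨⟨_, hP, (hval _ hP).trans hsup.symm⟩, ?_⟩
    rw [hsup, EReal.bot_add, eq_comm, EReal.eq_bot_iff_forall_lt]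
    intro r
    obtain ⟨j, y, hy, hQy⟩ := exists_adjoint_eq_zero hK hne
    obtain ⟨V, U, hV, hU, h, hle⟩ :=
      exists_gaussCon_le_of_adjoint_eq_zero (K := K) hc hd hy hQy (r - 1)
    refine lt_of_le_of_lt (sInf_le ⟨V, U, hV, hU, h, rfl⟩) ?_
    exact EReal.coe_lt_coe_iff.2 (by linarith)

end FRBL
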